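/- One-shot visible quantum source coding: let {p_i, ψ_i}_{i∈I} be a finite ensemble of pure states on ℂ^d with positive definite average state ρ = ∑_i p_i ψ_i, and define for ε ∈ (0,1) the one-shot visible compression length m_v^{(1),ε} := inf{log M : M ∈ ℕ, 1 ≤ M ≤ d, and there exist states (χ_i)_{i∈I} on ℂ^M and a CPTP map 𝔇 in Kraus form from M×M matrices to d×d matrices with ∑_i p_i Tr(𝔇(χ_i) ψ_i) ≥ 1 − ε}. Then for every ε ∈ (0,1) and η > 0 with ε + η < 1: H̄_s^{ε+η}(ρ) + log η ≤ m_v^{(1),ε} ≤ H̄_s^ε(ρ), where H̄_s^ε(ρ) := −D̲_s^ε(ρ‖I_d). -/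

import Mathlib

open Matrix
open scoped ComplexOrder

noncomputable section

/-- Positive part `C₊` of a Hermitian matrix, obtained by applying `x ↦ max x 0` to the
eigenvalues in a spectral decomposition (junk value `0` for non-Hermitian input). -/
def matPos {n : Type*} [Fintype n] [DecidableEq n] (A : Matrix n n ℂ) : Matrix n n ℂ :=
  if hA : A.IsHermitian then
    (hA.eigenvectorUnitary : Matrix n n ℂ) *
      Matrix.diagonal (fun i => ((max (hA.eigenvalues i) 0 : ℝ) : ℂ)) *
      star (hA.eigenvectorUnitary : Matrix n n ℂ)
  else 0

/-- `Tr C₊` as a real number. -/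
def trPos {n : Type*} [Fintype n] [DecidableEq n] (A : Matrix n n ℂ) : ℝ :=
  (matPos A).trace.re

/-- Spectral projection of a Hermitian matrix onto `[0, ∞)` (junk value `0` for
non-Hermitian input). -/
def projNonneg {n : Type*} [Fintype n] [DecidableEq n] (A : Matrix n n ℂ) : Matrix n n ℂ :=
  if hA : A.IsHermitian then
    (hA.eigenvectorUnitary : Matrix n n ℂ) *
      Matrix.diagonal (fun i => if 0 ≤ hA.eigenvalues i then (1 : ℂ) else 0) *
      star (hA.eigenvectorUnitary : Matrix n n ℂ)
  else 0

/-- The information spectrum relative entropy `D̲_s^ε(ρ‖σ)`. -/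
def Dlow {n : Type*} [Fintype n] [DecidableEq n] (ε : ℝ) (ρ σ : Matrix n n ℂ) : ℝ :=
  sSup {γ : ℝ | 1 - ε ≤ trPos (ρ - (2 : ℝ) ^ γ • σ)}

/-- The information spectrum relative entropy `D̄_s^ε(ρ‖σ)`. -/
def Dhigh {n : Type*} [Fintype n] [DecidableEq n] (ε : ℝ) (ρ σ : Matrix n n ℂ) : ℝ :=
  sInf {γ : ℝ | trPos (ρ - (2 : ℝ) ^ γ • σ) ≤ ε}

/-- The `ε`-error one-shot visible compression length of the pure-state ensemble `{pᵢ, ψᵢ}`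
on `ℂ^d`: the infimum of `log M` over all `M` with `1 ≤ M ≤ d` for which there exist encoded
states `χᵢ` on `ℂ^M` and a CPTP decoder `𝔇` in Kraus form from `ℂ^{M×M}` to `ℂ^{d×d}` with
ensemble average fidelity `∑ᵢ pᵢ Tr(𝔇(χᵢ) ψᵢ) ≥ 1 − ε`. -/
def mVisible (d : ℕ) {I : Type} [Fintype I] (p : I → ℝ)
    (ψ : I → Matrix (Fin d) (Fin d) ℂ) (ε : ℝ) : ℝ :=
  sInf {r : ℝ | ∃ M : ℕ, 1 ≤ M ∧ M ≤ d ∧ r = Real.logb 2 M ∧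
    ∃ χ : I → Matrix (Fin M) (Fin M) ℂ, (∀ i, (χ i).PosSemidef ∧ (χ i).trace = 1) ∧
      ∃ (m : ℕ) (K : Fin m → Matrix (Fin d) (Fin M) ℂ),
        (∑ j, (K j)ᴴ * K j = (1 : Matrix (Fin M) (Fin M) ℂ)) ∧
        1 - ε ≤ ∑ i, p i * ((∑ j, K j * χ i * (K j)ᴴ) * ψ i).trace.re}

section Spectral

variable {n m : Type*} [Fintype n] [DecidableEq n] [Fintype m] [DecidableEq m]

lemma Matrix.IsHermitian.trace_mul_eq_sum {A : Matrix n n ℂ} (hA : A.IsHermitian)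
    (T : Matrix n n ℂ) :
    (A * T).trace = ∑ k, (hA.eigenvalues k : ℂ) *
      ((hA.eigenvectorUnitary : Matrix n n ℂ)ᴴ * T * (hA.eigenvectorUnitary : Matrix n n ℂ)) k k := by
  conv_lhs => rw [hA.spectral_theorem, Unitary.conjStarAlgAut_apply]
  rw [mul_assoc, mul_assoc, trace_mul_comm, mul_assoc, trace]
  simp [diagonal_mul, star_eq_conjTranspose, Function.comp]

lemma Matrix.PosSemidef.trace_mul_re_nonneg {A B : Matrix n n ℂ} (hA : A.PosSemidef)
    (hB : B.PosSemidef) : 0 ≤ (A * B).trace.re := by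
  rw [hA.isHermitian.trace_mul_eq_sum, Complex.re_sum]
  refine Finset.sum_nonneg fun k _ => ?_
  rw [Complex.re_ofReal_mul]
  exact mul_nonneg (hA.eigenvalues_nonneg k)
    (Complex.le_def.mp ((hB.conjTranspose_mul_mul_same _).diag_nonneg (i := k))).1

lemma trPos_eq_sum_eigenvalues {A : Matrix n n ℂ} (hA : A.IsHermitian) :
    trPos A = ∑ k, max (hA.eigenvalues k) 0 := by
  rw [trPos, matPos, dif_pos hA, trace_mul_comm, ← mul_assoc, Unitary.coe_star_mul_self, one_mul,
    trace_diagonal, ← Complex.ofReal_sum, Complex.ofReal_re]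

lemma posSemidef_one_sub_conj {T : Matrix n n ℂ} (hT : (1 - T).PosSemidef)
    {V : Matrix n m ℂ} (hV : Vᴴ * V = 1) : (1 - Vᴴ * T * V).PosSemidef := by
  have h := hT.conjTranspose_mul_mul_same V
  rwa [Matrix.mul_sub, Matrix.mul_one, Matrix.sub_mul, hV] at h

lemma trace_mul_re_le_trPos {A T : Matrix n n ℂ} (hA : A.IsHermitian) (hT : T.PosSemidef)
    (hT1 : (1 - T).PosSemidef) : (A * T).trace.re ≤ trPos A := by
  rw [hA.trace_mul_eq_sum, trPos_eq_sum_eigenvalues hA, Complex.re_sum]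
  refine Finset.sum_le_sum fun k _ => ?_
  rw [Complex.re_ofReal_mul]
  have hU : (hA.eigenvectorUnitary : Matrix n n ℂ)ᴴ * (hA.eigenvectorUnitary : Matrix n n ℂ) = 1 :=
    Unitary.coe_star_mul_self _
  have h0 := (Complex.le_def.mp ((hT.conjTranspose_mul_mul_same
    (hA.eigenvectorUnitary : Matrix n n ℂ)).diag_nonneg (i := k))).1
  have h1 := (Complex.le_def.mp ((posSemidef_one_sub_conj hT1 hU).diag_nonneg (i := k))).1
  simp only [Matrix.sub_apply, one_apply_eq, Complex.sub_re, Complex.one_re, Complex.zero_re] at h0 h1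
  calc _ ≤ max (hA.eigenvalues k) 0 * _ := mul_le_mul_of_nonneg_right (le_max_left _ _) h0
    _ ≤ max (hA.eigenvalues k) 0 * 1 :=
      mul_le_mul_of_nonneg_left (by linarith) (le_max_right _ _)
    _ = _ := mul_one _

lemma posSemidef_one_sub_mul_conjTranspose {V : Matrix n m ℂ} (hV : Vᴴ * V = 1) :
    (1 - V * Vᴴ).PosSemidef := by
  have h : (1 - V * Vᴴ) = (1 - V * Vᴴ)ᴴ * (1 - V * Vᴴ) := by
    have h2 : V * Vᴴ * (V * Vᴴ) = V * Vᴴ := by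
      rw [Matrix.mul_assoc, ← Matrix.mul_assoc Vᴴ, hV, Matrix.one_mul]
    simp [mul_sub, sub_mul, h2]
  rw [h]
  exact posSemidef_conjTranspose_mul_self _

/-- The isometry embeds the span of the eigenvectors with positive eigenvalue. -/
lemma exists_isometry_trPos_eq {A : Matrix n n ℂ} (hA : A.IsHermitian) :
    ∃ M ≤ Fintype.card n, ∃ V : Matrix n (Fin M) ℂ, Vᴴ * V = 1 ∧
      trPos A = (A * (V * Vᴴ)).trace.re := by
  set s := {k // 0 < hA.eigenvalues k}
  set U := (hA.eigenvectorUnitary : Matrix n n ℂ) with hUdef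
  have hU : Uᴴ * U = 1 := Unitary.coe_star_mul_self _
  let e : s ≃ Fin (Fintype.card s) := Fintype.equivFin s
  let V : Matrix n (Fin (Fintype.card s)) ℂ := U.submatrix id (fun k => (e.symm k : n))
  have hUV : Uᴴ * V = (1 : Matrix n n ℂ).submatrix id (fun k => (e.symm k : n)) := by
    rw [← hU]
    ext i j
    simp [V, mul_apply]
  refine ⟨_, Fintype.card_subtype_le _, V, ?_, ?_⟩
  · have h : Vᴴ * V = (1 : Matrix n n ℂ).submatrix (fun k => (e.symm k : n))
        (fun k => (e.symm k : n)) := by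
      rw [← hU]
      ext i j
      simp [V, mul_apply]
    rw [h]
    exact submatrix_one _ (Subtype.val_injective.comp e.symm.injective)
  · rw [hA.trace_mul_eq_sum, trPos_eq_sum_eigenvalues hA, Complex.re_sum]
    refine Finset.sum_congr rfl fun k _ => ?_
    have h : Uᴴ * (V * Vᴴ) * U = (Uᴴ * V) * (Uᴴ * V)ᴴ := by
      simp [Matrix.mul_assoc]
    rw [Complex.re_ofReal_mul, ← hUdef, h, hUV]
    by_cases hk : 0 < hA.eigenvalues k
    · have : ∀ x : Fin (Fintype.card s), k = (e.symm x : n) ↔ x = e ⟨k, hk⟩ := fun x => by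
        rw [← Equiv.symm_apply_eq, Subtype.ext_iff, eq_comm]
      rw [max_eq_left hk.le, mul_apply, Finset.sum_eq_single (e ⟨k, hk⟩)]
      · simp [one_apply]
      · intro b _ hb
        simp [one_apply, mt (this b).1 hb]
      · simp [one_apply]
    · have : ∀ x : Fin (Fintype.card s), k ≠ (e.symm x : n) :=
        fun x hx => hk (hx ▸ (e.symm x).2)
      rw [max_eq_right (not_lt.mp hk)]
      simp [mul_apply, one_apply, this]

lemma trPos_sub_smul_one {H : Matrix n n ℂ} (hH : H.IsHermitian) (c : ℝ) :
    trPos (H - c • (1 : Matrix n n ℂ)) =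
      (H.charpoly.roots.map fun z => max (z.re - c) 0).sum := by
  have hc : (H - c • (1 : Matrix n n ℂ)).IsHermitian :=
    hH.sub (by simp [IsHermitian])
  have hroots : (H - c • (1 : Matrix n n ℂ)).charpoly.roots =
      H.charpoly.roots.map (fun z => z - (c : ℂ)) := by
    have h1 : c • (1 : Matrix n n ℂ) = scalar n (c : ℂ) := by
      ext i j; simp [one_apply, diagonal_apply]
    rw [h1, charpoly_sub_scalar]
    have h2 : (Polynomial.X + Polynomial.C (c : ℂ)) = Polynomial.X - Polynomial.C (-(c : ℂ)) := by
      simp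
    rw [hH.charpoly_eq, Polynomial.prod_comp]
    have h3 : ∀ i, (Polynomial.X - Polynomial.C ((hH.eigenvalues i : ℝ) : ℂ)).comp
        (Polynomial.X + Polynomial.C (c : ℂ)) =
        Polynomial.X - Polynomial.C ((hH.eigenvalues i : ℂ) - c) := fun i => by
      simp; ring
    simp only [Complex.coe_algebraMap] at *
    simp only [h3]
    have h4 : ∀ f : n → ℂ, (∏ i, (Polynomial.X - Polynomial.C (f i))).roots =
        Finset.univ.val.map f := fun f => by
      rw [← Polynomial.roots_multiset_prod_X_sub_C (Finset.univ.val.map f), Multiset.map_map]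
      rfl
    rw [h4, h4, Multiset.map_map]
    rfl
  have h := hc.roots_charpoly_eq_eigenvalues
  rw [trPos_eq_sum_eigenvalues hc]
  have h4 : (∑ k, max (hc.eigenvalues k) 0) =
    ((H - c • (1 : Matrix n n ℂ)).charpoly.roots.map fun z => max z.re 0).sum := by
    rw [h]; simp [Function.comp]
  rw [h4, hroots]
  simp

lemma trPos_mul_conjTranspose_sub (B : Matrix m n ℂ) {c : ℝ} (hc : 0 ≤ c) :
    trPos (B * Bᴴ - c • (1 : Matrix m m ℂ)) = trPos (Bᴴ * B - c • (1 : Matrix n n ℂ)) := by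
  rw [trPos_sub_smul_one (isHermitian_mul_conjTranspose_self B),
    trPos_sub_smul_one (isHermitian_conjTranspose_mul_self B)]
  have h := congrArg Polynomial.roots (charpoly_mul_comm' B Bᴴ)
  rw [Polynomial.roots_mul ((Polynomial.monic_X_pow _).mul (charpoly_monic _)).ne_zero,
    Polynomial.roots_mul ((Polynomial.monic_X_pow _).mul (charpoly_monic _)).ne_zero,
    Polynomial.roots_X_pow, Polynomial.roots_X_pow] at h
  have h2 := congrArg (fun s => (s.map fun z : ℂ => max (z.re - c) 0).sum) h
  simpa [Multiset.map_nsmul, Multiset.sum_nsmul, hc] using h2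

end Spectral

section TracePositivePart

variable {n m J : Type*} [Fintype n] [DecidableEq n] [Fintype m] [DecidableEq m] [Fintype J]

lemma trPos_mono {A B : Matrix n n ℂ} (hA : A.IsHermitian) (hAB : (B - A).PosSemidef) :
    trPos A ≤ trPos B := by
  have hB : B.IsHermitian := by simpa using hAB.isHermitian.add hA
  obtain ⟨M, -, V, hV, h⟩ := exists_isometry_trPos_eq hA
  rw [h]
  refine le_trans ?_ (trace_mul_re_le_trPos hB (posSemidef_self_mul_conjTranspose V)
    (posSemidef_one_sub_mul_conjTranspose hV))
  have h2 := hAB.trace_mul_re_nonneg (posSemidef_self_mul_conjTranspose V)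
  rw [Matrix.sub_mul, trace_sub, Complex.sub_re] at h2
  linarith

/-- A trace-preserving map in Kraus form does not increase the trace of the positive part. -/
lemma trPos_sum_conj_le {A : Matrix n n ℂ} (hA : A.IsHermitian) (D : J → Matrix n n ℂ)
    (hD : ∑ j, D j * (D j)ᴴ = 1) : trPos (∑ j, (D j)ᴴ * A * D j) ≤ trPos A := by
  have hA' : (∑ j, (D j)ᴴ * A * D j).IsHermitian := by
    simp [IsHermitian, conjTranspose_sum, Matrix.mul_assoc, hA.eq]
  obtain ⟨M, -, V, hV, h⟩ := exists_isometry_trPos_eq hA'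
  have hQ := posSemidef_self_mul_conjTranspose V
  have hQ1 := posSemidef_one_sub_mul_conjTranspose hV
  generalize V * Vᴴ = Q at *
  have h1 : 1 - ∑ j, D j * Q * (D j)ᴴ = ∑ j, D j * (1 - Q) * (D j)ᴴ := by
    simp [Matrix.mul_sub, Matrix.sub_mul, hD]
  have h2 : ((∑ j, (D j)ᴴ * A * D j) * Q).trace = (A * ∑ j, D j * Q * (D j)ᴴ).trace := by
    simp only [Matrix.sum_mul, Matrix.mul_sum, trace_sum]
    refine Finset.sum_congr rfl fun j _ => ?_
    rw [Matrix.mul_assoc, Matrix.mul_assoc, trace_mul_comm]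
    simp only [Matrix.mul_assoc]
  rw [h, h2]
  refine trace_mul_re_le_trPos hA
    (posSemidef_sum _ fun j _ => hQ.mul_mul_conjTranspose_same _) ?_
  rw [h1]
  exact posSemidef_sum _ fun j _ => hQ1.mul_mul_conjTranspose_same _

lemma posSemidef_sum_conjTranspose_mul_self_sub (K : J → Matrix n m ℂ)
    (hK : ∑ j, (K j)ᴴ * K j = 1) {I : Type*} [Fintype I] (X : J → Matrix n I ℂ) :
    (∑ j, (X j)ᴴ * X j - (∑ j, (K j)ᴴ * X j)ᴴ * ∑ j, (K j)ᴴ * X j).PosSemidef := by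
  classical
  let V : Matrix (J × n) m ℂ := of fun x k => K x.1 x.2 k
  let Z : Matrix (J × n) I ℂ := of fun x i => X x.1 x.2 i
  have hVV : Vᴴ * V = 1 := by
    rw [← hK]
    ext a b
    simp [V, mul_apply, Fintype.sum_prod_type, Matrix.sum_apply]
  have hVZ : Vᴴ * Z = ∑ j, (K j)ᴴ * X j := by
    ext a b
    simp [V, Z, mul_apply, Fintype.sum_prod_type, Matrix.sum_apply]
  have hZZ : Zᴴ * Z = ∑ j, (X j)ᴴ * X j := by
    ext a b
    simp [Z, mul_apply, Fintype.sum_prod_type, Matrix.sum_apply]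
  rw [← hVZ, ← hZZ]
  have h := (posSemidef_one_sub_mul_conjTranspose hVV).conjTranspose_mul_mul_same Z
  simpa [Matrix.mul_sub, Matrix.sub_mul, Matrix.mul_assoc] using h

lemma exists_trace_le_eigenvalue {N χ : Matrix n n ℂ} (hN : N.IsHermitian) (hχ : χ.PosSemidef)
    (hχ1 : χ.trace = 1) : ∃ k, (N * χ).trace.re ≤ hN.eigenvalues k := by
  set U := (hN.eigenvectorUnitary : Matrix n n ℂ) with hUdef
  have hU : U * Uᴴ = 1 := Unitary.coe_mul_star_self _
  have hw : ∀ k, 0 ≤ ((Uᴴ * χ * U) k k).re := fun k =>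
    (Complex.le_def.mp ((hχ.conjTranspose_mul_mul_same U).diag_nonneg (i := k))).1
  have hw1 : ∑ k, ((Uᴴ * χ * U) k k).re = 1 := by
    have h : (Uᴴ * χ * U).trace = 1 := by
      rw [trace_mul_comm, ← Matrix.mul_assoc, hU, Matrix.one_mul, hχ1]
    rw [← Complex.re_sum]
    exact congrArg Complex.re h
  have ht : (N * χ).trace.re = ∑ k, hN.eigenvalues k * ((Uᴴ * χ * U) k k).re := by
    rw [hN.trace_mul_eq_sum, Complex.re_sum]
    simp [hUdef]
  by_contra! hlt
  have h0 : ∑ k, ((N * χ).trace.re - hN.eigenvalues k) * ((Uᴴ * χ * U) k k).re = 0 := by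
    simp only [sub_mul, Finset.sum_sub_distrib, ← Finset.mul_sum, hw1, ← ht]
    ring
  rw [Finset.sum_eq_zero_iff_of_nonneg
    fun k _ => mul_nonneg (sub_nonneg.2 (hlt k).le) (hw k)] at h0
  have : ∀ k, ((Uᴴ * χ * U) k k).re = 0 := fun k =>
    (mul_eq_zero.1 (h0 k (Finset.mem_univ k))).resolve_left (sub_pos.2 (hlt k)).ne'
  simp [this] at hw1

lemma exists_unit_vector_trace_le {χ : Matrix n n ℂ} (hχ : χ.PosSemidef) (hχ1 : χ.trace = 1)
    [Nonempty J] (L : Matrix n J ℂ) :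
    ∃ e : J → ℂ, star e ⬝ᵥ e = 1 ∧
      (L * Lᴴ * χ).trace.re ≤ (star (L *ᵥ e) ⬝ᵥ (L *ᵥ e)).re := by
  classical
  have hN := isHermitian_mul_conjTranspose_self L
  obtain ⟨k, hk⟩ := exists_trace_le_eigenvalue hN hχ hχ1
  rcases le_or_gt (hN.eigenvalues k) 0 with h0 | h0
  · refine ⟨Pi.single (Classical.arbitrary J) 1, by simp [Pi.star_single], hk.trans (h0.trans ?_)⟩
    exact (Complex.le_def.mp (dotProduct_star_self_nonneg _)).1
  · set u : n → ℂ := ⇑(hN.eigenvectorBasis k)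
    set l := hN.eigenvalues k
    have hu : star u ⬝ᵥ u = 1 := by
      have := hN.eigenvectorBasis.orthonormal.1 k
      have h2 := inner_self_eq_norm_sq_to_K (𝕜 := ℂ) (hN.eigenvectorBasis k)
      rw [this, EuclideanSpace.inner_eq_star_dotProduct] at h2
      simpa [dotProduct_comm] using h2
    have hNu : (L * Lᴴ) *ᵥ u = (l : ℂ) • u := by
      simpa using hN.mulVec_eigenvectorBasis k
    have hs : ((√l : ℝ) : ℂ) * (√l : ℝ) = l := by
      rw [← Complex.ofReal_mul, Real.mul_self_sqrt h0.le]
    have hs0 : ((√l : ℝ) : ℂ) ≠ 0 := by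
      simpa using (Real.sqrt_pos.2 h0).ne'
    have hL : L *ᵥ (((√l : ℝ) : ℂ)⁻¹ • (Lᴴ *ᵥ u)) = ((√l : ℝ) : ℂ) • u := by
      rw [mulVec_smul, mulVec_mulVec, hNu, smul_smul, ← hs, inv_mul_cancel_left₀ hs0]
    refine ⟨((√l : ℝ) : ℂ)⁻¹ • (Lᴴ *ᵥ u), ?_, ?_⟩
    · have h3 : star (Lᴴ *ᵥ u) ⬝ᵥ (Lᴴ *ᵥ u) = l := by
        rw [star_mulVec, conjTranspose_conjTranspose, ← dotProduct_mulVec, mulVec_mulVec, hNu]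
        simp [hu]
      simp only [star_smul, smul_dotProduct, dotProduct_smul, h3]
      rw [← hs]
      simp
      field_simp
    · rw [hL]
      refine hk.trans_eq ?_
      simp only [star_smul, smul_dotProduct, dotProduct_smul, hu]
      simp [Real.mul_self_sqrt h0.le]

end TracePositivePart

section Coding

variable {d : ℕ} {I : Type} [Fintype I]

lemma exists_eq_vecMulVec_star {n : Type*} [Fintype n] {ψ : Matrix n n ℂ}
    (hψ : ψ.IsHermitian) (hψ2 : ψ * ψ = ψ) (hψ1 : ψ.trace = 1) :
    ∃ v : n → ℂ, ψ = vecMulVec v (star v) := by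
  have hne : ψ ≠ 0 := by
    rintro rfl
    simp at hψ1
  obtain ⟨u, t, ht, hu0, hu⟩ := hψ.exists_eigenvector_of_ne_zero hne
  have hψu : ψ *ᵥ u = u := by
    have h : t • (t • u) = t • u := by
      rw [← hu, ← mulVec_smul, ← hu, mulVec_mulVec, hψ2]
    rwa [hu, ← (smul_right_injective (n → ℂ) ht).eq_iff]
  have hs : 0 < star u ⬝ᵥ u := dotProduct_star_self_pos_iff.2 hu0
  obtain ⟨hs0, hs1⟩ := Complex.lt_def.mp hs
  set s := (star u ⬝ᵥ u).re with hsdef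
  have hsu : star u ⬝ᵥ u = ((√s : ℝ) : ℂ) * (√s : ℝ) := by
    rw [← Complex.ofReal_mul, Real.mul_self_sqrt (by simpa using hs0.le)]
    exact Complex.ext (by simp [hsdef]) (by simpa using hs1.symm)
  have hs2 : ((√s : ℝ) : ℂ) ≠ 0 := by
    simpa using (Real.sqrt_pos.2 (by simpa using hs0)).ne'
  set v := ((√s : ℝ) : ℂ)⁻¹ • u with hv
  have hvv : star v ⬝ᵥ v = 1 := by
    simp only [hv, star_smul, smul_dotProduct, dotProduct_smul, hsu]
    simp
    field_simp
  have hψv : ψ *ᵥ v = v := by rw [hv, mulVec_smul, hψu]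
  have hvψ : star v ᵥ* ψ = star v := by
    simpa [star_mulVec, hψ.eq] using congrArg star hψv
  refine ⟨v, sub_eq_zero.1 (trace_conjTranspose_mul_self_eq_zero_iff.1 ?_)⟩
  simp [Matrix.sub_mul, Matrix.mul_sub, hψ.eq, hψ2, mul_vecMulVec, vecMulVec_mul, hψv, hvψ,
    conjTranspose_vecMulVec, sub_mulVec, vecMulVec_mulVec, trace_vecMulVec, hvv, hψ1, dotProduct_comm v]

lemma sq_trace_mul_le {n : Type*} [Fintype n] {ψ P : Matrix n n ℂ} (hψ : ψ.IsHermitian)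
    (hψ2 : ψ * ψ = ψ) (hψ1 : ψ.trace = 1) (hP : P.IsHermitian) :
    (P * ψ).trace.re ^ 2 ≤ (P * ψ * P * ψ).trace.re := by
  obtain ⟨t, ht⟩ : ∃ t, t = (P * ψ).trace.re := ⟨_, rfl⟩
  set Y := ψ * P * ψ - (t : ℂ) • ψ with hY
  have hYH : Yᴴ = Y := by simp [hY, hψ.eq, hP.eq, Matrix.mul_assoc]
  have h0 := (Complex.le_def.mp (posSemidef_conjTranspose_mul_self Y).trace_nonneg).1
  have h1 : (ψ * P * ψ).trace = (P * ψ).trace := by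
    rw [Matrix.mul_assoc, trace_mul_comm, Matrix.mul_assoc, hψ2]
  have h2 : (ψ * P * ψ * P * ψ).trace = (P * ψ * P * ψ).trace := by
    rw [Matrix.mul_assoc, Matrix.mul_assoc, Matrix.mul_assoc, trace_mul_comm]
    simp only [Matrix.mul_assoc, hψ2]
  have h3 : Y * Y = ψ * P * ψ * P * ψ - (t : ℂ) • (ψ * P * ψ) - (t : ℂ) • (ψ * P * ψ)
      + ((t : ℂ) * t) • ψ := by
    have h4 : ∀ Z : Matrix n n ℂ, ψ * (ψ * Z) = ψ * Z := fun Z => by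
      rw [← Matrix.mul_assoc, hψ2]
    simp only [hY, Matrix.sub_mul, Matrix.mul_sub, Matrix.mul_assoc, hψ2, h4, smul_mul_assoc,
      mul_smul_comm]
    module
  rw [hYH, h3] at h0
  simp only [trace_add, trace_sub, trace_smul, h1, h2, hψ1, smul_eq_mul, Complex.add_re,
    Complex.sub_re, Complex.re_ofReal_mul, ← Complex.ofReal_mul, mul_one, Complex.ofReal_re,
    Complex.zero_re, ← ht] at h0
  rw [← ht]
  nlinarith

lemma exists_compressed_state {M : ℕ} (hM : 1 ≤ M) {V : Matrix (Fin d) (Fin M) ℂ}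
    {ψ : Matrix (Fin d) (Fin d) ℂ}
    (hψ : ψ.IsHermitian) (hψ2 : ψ * ψ = ψ) (hψ1 : ψ.trace = 1) :
    ∃ χ : Matrix (Fin M) (Fin M) ℂ, (χ.PosSemidef ∧ χ.trace = 1) ∧
      (ψ * (V * Vᴴ)).trace.re ≤ (V * χ * Vᴴ * ψ).trace.re := by
  have hψ0 : ψ.PosSemidef := by
    have h := posSemidef_conjTranspose_mul_self ψ
    rwa [hψ.eq, hψ2] at h
  have hσ := hψ0.conjTranspose_mul_mul_same V
  have htr : (Vᴴ * ψ * V).trace = (ψ * (V * Vᴴ)).trace := by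
    rw [Matrix.mul_assoc, trace_mul_comm, Matrix.mul_assoc]
  have hpos := Complex.le_def.mp hσ.trace_nonneg
  rw [htr] at hpos
  set t := (ψ * (V * Vᴴ)).trace.re with ht
  have htt : (ψ * (V * Vᴴ)).trace = (t : ℂ) :=
    Complex.ext (by simp [ht]) (by simpa using hpos.2.symm)
  have ht0 : 0 ≤ t := hpos.1
  rcases ht0.eq_or_lt with h0 | h0
  · have hM0 : (M : ℂ) ≠ 0 := by exact_mod_cast (by omega : M ≠ 0)
    have hχ : (((M : ℂ)⁻¹) • (1 : Matrix (Fin M) (Fin M) ℂ)).PosSemidef :=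
      PosSemidef.one.smul (by positivity)
    refine ⟨_, ⟨hχ, by simp [hM0]⟩, ?_⟩
    rw [← h0]
    exact (hχ.mul_mul_conjTranspose_same V).trace_mul_re_nonneg hψ0
  · have ht' : (t : ℂ) ≠ 0 := by exact_mod_cast h0.ne'
    refine ⟨((t⁻¹ : ℝ) : ℂ) • (Vᴴ * ψ * V), ⟨hσ.smul ?_, ?_⟩, ?_⟩
    · exact_mod_cast (inv_nonneg.2 ht0)
    · simp [htr, htt, ht']
    · have h := sq_trace_mul_le hψ hψ2 hψ1 (isHermitian_mul_conjTranspose_self V)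
      rw [trace_mul_comm (V * Vᴴ) ψ, ← ht] at h
      have h2 : V * (((t⁻¹ : ℝ) : ℂ) • (Vᴴ * ψ * V)) * Vᴴ * ψ =
          ((t⁻¹ : ℝ) : ℂ) • (V * Vᴴ * ψ * (V * Vᴴ) * ψ) := by
        simp [Matrix.mul_assoc]
      rw [h2, trace_smul, smul_eq_mul, Complex.re_ofReal_mul]
      calc t = t⁻¹ * t ^ 2 := by field_simp
        _ ≤ _ := mul_le_mul_of_nonneg_left h (inv_nonneg.2 ht0)

lemma trace_sub_smul_one_mul_re {n : Type*} [Fintype n] [DecidableEq n] (A Q : Matrix n n ℂ)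
    (c : ℝ) : ((A - c • (1 : Matrix n n ℂ)) * Q).trace.re = (A * Q).trace.re - c * Q.trace.re := by
  simp [Matrix.sub_mul]

/-- Projecting onto the span of the eigenvectors with eigenvalue larger than `c` gives a code. -/
lemma exists_code (p : I → ℝ) (hp : ∀ i, 0 ≤ p i)
    (ψ : I → Matrix (Fin d) (Fin d) ℂ)
    (hψ : ∀ i, (ψ i).IsHermitian ∧ ψ i * ψ i = ψ i ∧ (ψ i).trace = 1)
    (hρ : (∑ i, p i • ψ i).PosSemidef) (hρ1 : (∑ i, p i • ψ i).trace = 1)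
    {ε c : ℝ} (hε1 : ε < 1) (hc : 0 ≤ c)
    (h : 1 - ε ≤ trPos ((∑ i, p i • ψ i) - c • (1 : Matrix (Fin d) (Fin d) ℂ))) :
    ∃ M : ℕ, 1 ≤ M ∧ M ≤ d ∧ c * M ≤ 1 ∧
      ∃ χ : I → Matrix (Fin M) (Fin M) ℂ, (∀ i, (χ i).PosSemidef ∧ (χ i).trace = 1) ∧
      ∃ (m : ℕ) (K : Fin m → Matrix (Fin d) (Fin M) ℂ),
        (∑ j, (K j)ᴴ * K j = (1 : Matrix (Fin M) (Fin M) ℂ)) ∧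
        1 - ε ≤ ∑ i, p i * ((∑ j, K j * χ i * (K j)ᴴ) * ψ i).trace.re := by
  have hH : ((∑ i, p i • ψ i) - c • (1 : Matrix (Fin d) (Fin d) ℂ)).IsHermitian :=
    hρ.isHermitian.sub (by simp [IsHermitian])
  obtain ⟨M, hMd, V, hV, hT⟩ := exists_isometry_trPos_eq hH
  rw [Fintype.card_fin] at hMd
  have hM : 1 ≤ M := by
    by_contra! hM
    obtain rfl : M = 0 := by omega
    have : V * Vᴴ = 0 := by ext; simp [mul_apply]
    simp [this] at hT
    linarith
  have hVM : (V * Vᴴ).trace.re = M := by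
    rw [trace_mul_comm, hV]; simp
  rw [trace_sub_smul_one_mul_re, hVM] at hT
  have hle := hρ.trace_mul_re_nonneg (posSemidef_one_sub_mul_conjTranspose hV)
  rw [Matrix.mul_sub, Matrix.mul_one, trace_sub, hρ1, Complex.sub_re, Complex.one_re] at hle
  choose χ hχ hF using fun i =>
    exists_compressed_state hM (V := V) (hψ i).1 (hψ i).2.1 (hψ i).2.2
  refine ⟨M, hM, hMd, by linarith, χ, hχ, 1, fun _ => V, by simpa using hV, ?_⟩
  have hsum : ((∑ i, p i • ψ i) * (V * Vᴴ)).trace.re =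
      ∑ i, p i * (ψ i * (V * Vᴴ)).trace.re := by
    simp [Matrix.sum_mul, trace_sum]
  have hcM : 0 ≤ c * M := by positivity
  calc 1 - ε ≤ ∑ i, p i * (ψ i * (V * Vᴴ)).trace.re := by rw [← hsum]; linarith
    _ ≤ _ := Finset.sum_le_sum fun i _ => by
      simpa using mul_le_mul_of_nonneg_left (hF i) (hp i)

/-- The converse bound on the fidelity of a visible code. -/
lemma fidelity_sub_le_trPos (p : I → ℝ) (hp : ∀ i, 0 ≤ p i)
    (ψ : I → Matrix (Fin d) (Fin d) ℂ)
    (hψ : ∀ i, (ψ i).IsHermitian ∧ ψ i * ψ i = ψ i ∧ (ψ i).trace = 1)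
    {M : ℕ} (hM : 1 ≤ M) (χ : I → Matrix (Fin M) (Fin M) ℂ)
    (hχ : ∀ i, (χ i).PosSemidef ∧ (χ i).trace = 1) {m : ℕ}
    (K : Fin m → Matrix (Fin d) (Fin M) ℂ)
    (hK : ∑ j, (K j)ᴴ * K j = (1 : Matrix (Fin M) (Fin M) ℂ)) {c : ℝ} (hc : 0 ≤ c) :
    (∑ i, p i * ((∑ j, K j * χ i * (K j)ᴴ) * ψ i).trace.re) - c * M ≤
      trPos ((∑ i, p i • ψ i) - c • (1 : Matrix (Fin d) (Fin d) ℂ)) := by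
  classical
  have hm : Nonempty (Fin m) := by
    by_contra hm
    rw [not_nonempty_iff] at hm
    have h : (0 : ℂ) = M := by simpa using congrArg trace hK
    have h0 : 0 = M := by exact_mod_cast h
    omega
  choose v hv using fun i => exists_eq_vecMulVec_star (hψ i).1 (hψ i).2.1 (hψ i).2.2
  let L : I → Matrix (Fin M) (Fin m) ℂ := fun i => of fun a j => ((K j)ᴴ *ᵥ v i) a
  have hL : ∀ i, L i * (L i)ᴴ = ∑ j, (K j)ᴴ * ψ i * K j := fun i => by
    have h : ∀ j, (K j)ᴴ * ψ i * K j = vecMulVec ((K j)ᴴ *ᵥ v i) (star ((K j)ᴴ *ᵥ v i)) :=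
      fun j => by
        rw [hv i, mul_vecMulVec, vecMulVec_mul, star_mulVec, conjTranspose_conjTranspose]
    simp only [h]
    ext a b
    simp [L, mul_apply, Matrix.sum_apply, vecMulVec_apply]
  choose e he heL using fun i => exists_unit_vector_trace_le (hχ i).1 (hχ i).2 (L i)
  have hF : ∀ i, ((∑ j, K j * χ i * (K j)ᴴ) * ψ i).trace.re ≤
      (star (L i *ᵥ e i) ⬝ᵥ (L i *ᵥ e i)).re := fun i => by
    refine le_of_eq_of_le ?_ (heL i)
    rw [hL]
    simp only [Matrix.sum_mul, trace_sum]
    congr 1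
    refine Finset.sum_congr rfl fun j _ => ?_
    rw [Matrix.mul_assoc, Matrix.mul_assoc, trace_mul_comm, Matrix.mul_assoc, trace_mul_comm]
  let W : Matrix (Fin d) I ℂ := of fun a i => ((√(p i) : ℝ) : ℂ) * v i a
  have hs : ∀ i, ((√(p i) : ℝ) : ℂ) * (√(p i) : ℝ) = p i := fun i => by
    rw [← Complex.ofReal_mul, Real.mul_self_sqrt (hp i)]
  have hW : W * Wᴴ = ∑ i, p i • ψ i := by
    ext a b
    simp only [W, mul_apply, Matrix.sum_apply, Matrix.smul_apply, of_apply, conjTranspose_apply]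
    refine Finset.sum_congr rfl fun i _ => ?_
    rw [hv i, vecMulVec_apply, Complex.real_smul, ← hs i]
    simp
    ring
  let D : Fin m → Matrix I I ℂ := fun j => diagonal fun i => e i j
  have hD : ∑ j, D j * (D j)ᴴ = 1 := by
    ext a b
    by_cases hab : a = b
    · subst hab
      simpa [D, Matrix.sum_apply, diagonal_conjTranspose, dotProduct, mul_comm] using he a
    · simp [D, Matrix.sum_apply, diagonal_conjTranspose, hab]
  have hD' : ∑ j, (D j)ᴴ * D j = 1 := by
    rw [← hD]
    simp [D, diagonal_conjTranspose, mul_comm]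
  set Y : Matrix (Fin M) I ℂ := ∑ j, (K j)ᴴ * (W * D j) with hY
  have hYa : ∀ a i, Y a i = ((√(p i) : ℝ) : ℂ) * (L i *ᵥ e i) a := fun a i => by
    simp only [hY, Matrix.sum_apply, mulVec, dotProduct, Finset.mul_sum, L, of_apply]
    refine Finset.sum_congr rfl fun j _ => ?_
    have hWD : ∀ b, (W * D j) b i = ((√(p i) : ℝ) : ℂ) * v i b * e i j := fun b => by
      simp [W, D]
    simp only [mul_apply (M := (K j)ᴴ), hWD, Finset.sum_mul, Finset.mul_sum]
    refine Finset.sum_congr rfl fun b _ => ?_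
    ring
  have hYtr : (Y * Yᴴ).trace.re = ∑ i, p i * (star (L i *ᵥ e i) ⬝ᵥ (L i *ᵥ e i)).re := by
    rw [trace_mul_comm, trace, Complex.re_sum]
    refine Finset.sum_congr rfl fun i _ => ?_
    rw [← Complex.re_ofReal_mul, ← hs i]
    congr 1
    simp only [diag_apply, mul_apply, conjTranspose_apply, hYa, dotProduct, Finset.mul_sum]
    refine Finset.sum_congr rfl fun b _ => ?_
    simp
    ring
  have hherm : ∀ {n : Type} [Fintype n] [DecidableEq n] {A : Matrix n n ℂ},
      A.IsHermitian → (A - c • (1 : Matrix n n ℂ)).IsHermitian := fun hA =>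
    hA.sub (by simp [IsHermitian])
  calc (∑ i, p i * ((∑ j, K j * χ i * (K j)ᴴ) * ψ i).trace.re) - c * M
      ≤ (Y * Yᴴ).trace.re - c * M := by
        rw [hYtr]
        exact sub_le_sub_right
          (Finset.sum_le_sum fun i _ => mul_le_mul_of_nonneg_left (hF i) (hp i)) _
    _ = ((Y * Yᴴ - c • (1 : Matrix (Fin M) (Fin M) ℂ)) * 1).trace.re := by
        rw [trace_sub_smul_one_mul_re]; simp
    _ ≤ trPos (Y * Yᴴ - c • (1 : Matrix (Fin M) (Fin M) ℂ)) :=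
        trace_mul_re_le_trPos (hherm (isHermitian_mul_conjTranspose_self Y)) PosSemidef.one
          (by simpa using PosSemidef.zero)
    _ = trPos (Yᴴ * Y - c • (1 : Matrix I I ℂ)) := trPos_mul_conjTranspose_sub Y hc
    _ ≤ trPos (∑ j, (W * D j)ᴴ * (W * D j) - c • (1 : Matrix I I ℂ)) := by
        refine trPos_mono (hherm (isHermitian_conjTranspose_mul_self Y)) ?_
        rw [sub_sub_sub_cancel_right]
        exact posSemidef_sum_conjTranspose_mul_self_sub K hK fun j => W * D j
    _ = trPos (∑ j, (D j)ᴴ * (Wᴴ * W - c • (1 : Matrix I I ℂ)) * D j) := by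
        congr 1
        simp [Matrix.mul_sub, Matrix.sub_mul, ← Finset.smul_sum, hD', Matrix.mul_assoc]
    _ ≤ trPos (Wᴴ * W - c • (1 : Matrix I I ℂ)) :=
        trPos_sum_conj_le (hherm (isHermitian_conjTranspose_mul_self W)) D hD
    _ = _ := by rw [← trPos_mul_conjTranspose_sub W hc, hW]

end Coding

/-- One-shot bounds for visible quantum source coding:
`H̄_s^{ε+η}(ρ) + log η ≤ m_v^{(1),ε} ≤ H̄_s^ε(ρ)`, where `H̄_s^ε(ρ) = −D̲_s^ε(ρ‖1)`. -/
theorem visible_source_coding_one_shot {d : ℕ} {I : Type} [Fintype I]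
    (p : I → ℝ) (hp : ∀ i, 0 ≤ p i) (hpsum : ∑ i, p i = 1)
    (ψ : I → Matrix (Fin d) (Fin d) ℂ)
    (hψ : ∀ i, (ψ i).IsHermitian ∧ ψ i * ψ i = ψ i ∧ (ψ i).trace = 1)
    (hρ : (∑ i, p i • ψ i).PosDef)
    (ε η : ℝ) (hε : 0 < ε) (hε1 : ε < 1) (hη : 0 < η) (hεη : ε + η < 1) :
    -Dlow (ε + η) (∑ i, p i • ψ i) (1 : Matrix (Fin d) (Fin d) ℂ) + Real.logb 2 η ≤
        mVisible d p ψ ε ∧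
      mVisible d p ψ ε ≤ -Dlow ε (∑ i, p i • ψ i) (1 : Matrix (Fin d) (Fin d) ℂ) := by
  have hρ1 : (∑ i, p i • ψ i).trace = 1 := by
    simp only [trace_sum, trace_smul, (hψ _).2.2, Complex.real_smul, mul_one]
    exact_mod_cast hpsum
  have hcode := fun {ε γ : ℝ} (hε1 : ε < 1)
      (h : 1 - ε ≤ trPos ((∑ i, p i • ψ i) - (2 : ℝ) ^ γ • (1 : Matrix (Fin d) (Fin d) ℂ))) =>
    exists_code p hp ψ hψ hρ.posSemidef hρ1 hε1 (by positivity) h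
  have hlog : ∀ {γ : ℝ} {M : ℕ}, 1 ≤ M → (2 : ℝ) ^ γ * M ≤ 1 → Real.logb 2 M ≤ -γ := by
    intro γ M hM h
    have hM0 : (0 : ℝ) < M := by exact_mod_cast hM
    rw [Real.logb_le_iff_le_rpow one_lt_two hM0, Real.rpow_neg two_pos.le,
      ← one_div, le_div_iff₀ (by positivity), mul_comm]
    exact h
  have hd : 0 < d := by
    rcases d.eq_zero_or_pos with rfl | hd
    · simp at hρ1
    · exact hd
  have hd0 : (0 : ℝ) < d := by exact_mod_cast hd
  have hne : ∀ {ε : ℝ}, 0 < ε →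
      {γ : ℝ | 1 - ε ≤ trPos ((∑ i, p i • ψ i) -
        (2 : ℝ) ^ γ • (1 : Matrix (Fin d) (Fin d) ℂ))}.Nonempty := by
    intro ε hε
    refine ⟨Real.logb 2 (ε / d), ?_⟩
    rw [Set.mem_ofPred_eq, Real.rpow_logb two_pos (by norm_num) (by positivity)]
    have h := trace_mul_re_le_trPos
      (hρ.isHermitian.sub (B := (ε / d) • (1 : Matrix (Fin d) (Fin d) ℂ)) (by simp [IsHermitian]))
      PosSemidef.one (by simpa using PosSemidef.zero)
    rw [trace_sub_smul_one_mul_re, Matrix.mul_one, hρ1] at h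
    simpa [hd0.ne'] using h
  constructor
  · refine le_csInf ?_ ?_
    · obtain ⟨γ, hγ⟩ := hne hε
      obtain ⟨M, hM, hMd, -, hrest⟩ := hcode hε1 hγ
      exact ⟨_, M, hM, hMd, rfl, hrest⟩
    · rintro r ⟨M, hM, -, rfl, χ, hχ, m, K, hK, hF⟩
      have hM0 : (0 : ℝ) < M := by exact_mod_cast hM
      have hmem : Real.logb 2 (η / M) ≤
          Dlow (ε + η) (∑ i, p i • ψ i) (1 : Matrix (Fin d) (Fin d) ℂ) := by
        refine le_csSup ⟨0, ?_⟩ ?_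
        · intro γ hγ
          obtain ⟨M', hM', -, hcM, -⟩ := hcode hεη hγ
          have h1 := hlog hM' hcM
          have h2 : 0 ≤ Real.logb 2 M' := Real.logb_nonneg one_lt_two (by exact_mod_cast hM')
          linarith
        · rw [Set.mem_ofPred_eq, Real.rpow_logb two_pos (by norm_num) (by positivity)]
          refine le_trans ?_ (fidelity_sub_le_trPos p hp ψ hψ hM χ hχ K hK (by positivity))
          rw [div_mul_cancel₀ _ hM0.ne']
          linarith
      rw [Real.logb_div hη.ne' hM0.ne'] at hmem
      linarith
  · rw [le_neg]
    refine csSup_le (hne hε) fun γ hγ => ?_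
    obtain ⟨M, hM, hMd, hcM, hrest⟩ := hcode hε1 hγ
    rw [le_neg]
    suffices h : mVisible d p ψ ε ≤ Real.logb 2 M from h.trans (hlog hM hcM)
    refine csInf_le ⟨0, ?_⟩ ⟨M, hM, hMd, rfl, hrest⟩
    rintro r ⟨M', hM', -, rfl, -⟩
    exact Real.logb_nonneg one_lt_two (by exact_mod_cast hM')
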